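/- arXiv:1401.4370 — 2 statements merged into one kernel-verified Lean document; each statement's English description precedes it below -/
import Mathlib

section
/- Let f : [a,b] → ℝ be absolutely continuous with f' essentially bounded, let w : [a,b] → [0,∞) be integrable, and let x ∈ (a,b) be such that m(a,x) > 0, m(x,b) > 0, and w(u) ≤ w(x) for almost every u ∈ [a,b]. Then |f(x) − (1/2)·[M(f,w;a,x) + M(f,w;x,b)]| ≤ [(x−a)²/m(a,x) + (b−x)²/m(x,b)]·w(x)·‖f'‖_∞/4. -/
open MeasureTheory intervalIntegral

/-- A function satisfying a Lipschitz bound around `x` differs from its weighted mean by at most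
the Lipschitz constant times the mean distance to `x`. -/
theorem abs_sub_weighted_mean_le {c d x M W : ℝ} {f w : ℝ → ℝ} (hcd : c ≤ d)
    (hw : IntervalIntegrable w volume c d) (hw0 : ∀ t ∈ Set.Icc c d, 0 ≤ w t)
    (hwW : ∀ᵐ t ∂(volume.restrict (Set.Icc c d)), w t ≤ W)
    (hf : ContinuousOn f (Set.Icc c d)) (hM : 0 ≤ M)
    (hfx : ∀ t ∈ Set.Icc c d, |f x - f t| ≤ M * |x - t|) (hm : 0 < ∫ t in c..d, w t) :
    |f x - (∫ t in c..d, f t * w t) / (∫ t in c..d, w t)| ≤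
      M * W * (∫ t in c..d, |x - t|) / (∫ t in c..d, w t) := by
  have hfw : IntervalIntegrable (fun t => f t * w t) volume c d :=
    hw.continuousOn_mul (by rwa [Set.uIcc_of_le hcd])
  have h_eq : f x - (∫ t in c..d, f t * w t) / (∫ t in c..d, w t) =
      (∫ t in c..d, (f x - f t) * w t) / (∫ t in c..d, w t) := by
    simp_rw [sub_mul]
    rw [integral_sub (hw.const_mul _) hfw, intervalIntegral.integral_const_mul]
    field_simp
  rw [h_eq, abs_div, abs_of_pos hm]
  gcongr
  rw [← intervalIntegral.integral_const_mul, ← Real.norm_eq_abs]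
  refine norm_integral_le_of_norm_le hcd ?_ (Continuous.intervalIntegrable (by fun_prop) _ _)
  rw [ae_restrict_iff' measurableSet_Icc] at hwW
  filter_upwards [hwW] with t ht htm
  have htI := Set.Ioc_subset_Icc_self htm
  rw [Real.norm_eq_abs, abs_mul, abs_of_nonneg (hw0 t htI)]
  calc |f x - f t| * w t ≤ (M * |x - t|) * W :=
        mul_le_mul (hfx t htI) (ht htI) (hw0 t htI) (by positivity)
    _ = M * W * |x - t| := by ring

/-- A function that is the integral of a density essentially bounded by `M` satisfies the
Lipschitz bound with constant `M`. -/
theorem abs_sub_le_of_eq_add_integral {a b M : ℝ} {f f' : ℝ → ℝ} (hab : a ≤ b)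
    (hf' : IntervalIntegrable f' volume a b)
    (hf : ∀ y ∈ Set.Icc a b, f y = f a + ∫ t in a..y, f' t)
    (hM : ∀ᵐ t ∂(volume.restrict (Set.Icc a b)), |f' t| ≤ M) {s t : ℝ}
    (hs : s ∈ Set.Icc a b) (ht : t ∈ Set.Icc a b) : |f s - f t| ≤ M * |s - t| := by
  have h_int : ∀ y ∈ Set.Icc a b, IntervalIntegrable f' volume a y := fun y hy =>
    hf'.mono_set (by
      rw [Set.uIcc_of_le hab, Set.uIcc_of_le hy.1]
      exact Set.Icc_subset_Icc_right hy.2)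
  rw [hf s hs, hf t ht, add_sub_add_left_eq_sub,
    integral_interval_sub_left (h_int s hs) (h_int t ht),
    ← Real.norm_eq_abs]
  refine norm_integral_le_of_norm_le_const_ae ?_
  rw [ae_restrict_iff' measurableSet_Icc] at hM
  filter_upwards [hM] with u hu hut
  exact hu (Set.uIcc_subset_Icc ht hs (Set.uIoc_subset_uIcc hut))

/-- **Corollary 1, `L_∞` case** (`α = β`). If `f` is absolutely continuous on `[a,b]`
(expressed via the fundamental theorem of calculus with integrable density `f'`), `f'` is
essentially bounded by `M` on `[a,b]`, `w ≥ 0` is an integrable weight, and `x ∈ (a,b)`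
satisfies `m(a,x) > 0`, `m(x,b) > 0` and `w(u) ≤ w(x)` for a.e. `u ∈ [a,b]`, then
`|f(x) − (1/2)·(M(f,w;a,x) + M(f,w;x,b))|
  ≤ ((x−a)²/m(a,x) + (b−x)²/m(x,b))·w(x)·M/4`. -/
theorem weighted_ostrowski_symmetric_Linfty (a b : ℝ) (hab : a < b)
    (f f' w : ℝ → ℝ) (M : ℝ)
    (hw_int : IntervalIntegrable w volume a b)
    (hw_nonneg : ∀ t ∈ Set.Icc a b, 0 ≤ w t)
    (hf'int : IntervalIntegrable f' volume a b)
    (hftc : ∀ y ∈ Set.Icc a b, f y = f a + ∫ t in a..y, f' t)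
    (hM : ∀ᵐ t ∂(volume.restrict (Set.Icc a b)), |f' t| ≤ M)
    (x : ℝ) (hx : x ∈ Set.Ioo a b)
    (hmax : 0 < ∫ t in a..x, w t) (hmxb : 0 < ∫ t in x..b, w t)
    (hw_le : ∀ᵐ u ∂(volume.restrict (Set.Icc a b)), w u ≤ w x) :
    |f x - (1 / 2) *
        ((∫ t in a..x, f t * w t) / (∫ t in a..x, w t) +
          (∫ t in x..b, f t * w t) / (∫ t in x..b, w t))| ≤
      ((x - a) ^ 2 / (∫ t in a..x, w t) + (b - x) ^ 2 / (∫ t in x..b, w t)) *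
        w x * M / 4 := by
  obtain ⟨hax, hxb⟩ := hx
  have hxI : x ∈ Set.Icc a b := ⟨hax.le, hxb.le⟩
  have h_lip : ∀ s ∈ Set.Icc a b, ∀ t ∈ Set.Icc a b, |f s - f t| ≤ M * |s - t| :=
    fun s hs t ht => abs_sub_le_of_eq_add_integral hab.le hf'int hftc hM hs ht
  have hM0 : 0 ≤ M := by
    have h := (abs_nonneg _).trans (h_lip x hxI a (Set.left_mem_Icc.2 hab.le))
    exact nonneg_of_mul_nonneg_left h (abs_pos.2 (sub_ne_zero.2 hax.ne'))
  have hf_cont : ContinuousOn f (Set.Icc a b) :=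
    (LipschitzOnWith.of_dist_le_mul (K := ⟨M, hM0⟩) h_lip).continuousOn
  have hl : Set.Icc a x ⊆ Set.Icc a b := Set.Icc_subset_Icc_right hxb.le
  have hr : Set.Icc x b ⊆ Set.Icc a b := Set.Icc_subset_Icc_left hax.le
  have hL := abs_sub_weighted_mean_le hax.le
    (hw_int.mono_set (by rwa [Set.uIcc_of_le hab.le, Set.uIcc_of_le hax.le]))
    (fun t ht => hw_nonneg t (hl ht)) (ae_restrict_of_ae_restrict_of_subset hl hw_le)
    (hf_cont.mono hl) hM0 (fun t ht => h_lip x hxI t (hl ht)) hmax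
  have hR := abs_sub_weighted_mean_le hxb.le
    (hw_int.mono_set (by rwa [Set.uIcc_of_le hab.le, Set.uIcc_of_le hxb.le]))
    (fun t ht => hw_nonneg t (hr ht)) (ae_restrict_of_ae_restrict_of_subset hr hw_le)
    (hf_cont.mono hr) hM0 (fun t ht => h_lip x hxI t (hr ht)) hmxb
  have h_left : ∫ t in a..x, |x - t| = (x - a) ^ 2 / 2 := by
    rw [integral_congr (g := fun t => x - t) fun t ht => abs_of_nonneg
      (sub_nonneg.2 (Set.uIcc_of_le hax.le ▸ ht).2), intervalIntegral.integral_comp_sub_left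
      (fun t => t), integral_id]
    ring
  have h_right : ∫ t in x..b, |x - t| = (b - x) ^ 2 / 2 := by
    rw [integral_congr (g := fun t => t - x) fun t ht => (abs_sub_comm x t).trans (abs_of_nonneg
      (sub_nonneg.2 (Set.uIcc_of_le hxb.le ▸ ht).1)), intervalIntegral.integral_comp_sub_right
      (fun t => t), integral_id]
    ring
  rw [h_left] at hL
  rw [h_right] at hR
  calc _ = |(1 / 2) * (f x - (∫ t in a..x, f t * w t) / (∫ t in a..x, w t)) +
        (1 / 2) * (f x - (∫ t in x..b, f t * w t) / (∫ t in x..b, w t))| := by ring_nf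
    _ ≤ (1 / 2) * |f x - (∫ t in a..x, f t * w t) / (∫ t in a..x, w t)| +
        (1 / 2) * |f x - (∫ t in x..b, f t * w t) / (∫ t in x..b, w t)| := by
      refine (abs_add_le _ _).trans_eq ?_
      rw [abs_mul, abs_mul, abs_of_pos (one_half_pos (α := ℝ))]
    _ ≤ (1 / 2) * (M * w x * ((x - a) ^ 2 / 2) / (∫ t in a..x, w t)) +
        (1 / 2) * (M * w x * ((b - x) ^ 2 / 2) / (∫ t in x..b, w t)) := by gcongr
    _ = _ := by ring
end

section
/- Let f : [a,b] → [0,∞) be an absolutely continuous probability density with respect to the weight w, i.e. ∫_a^b f(u)w(u) du = 1, let w : [a,b] → [0,∞) be integrable, let α, β ≥ 0 with α + β > 0, and let x ∈ (a,b) be such that m(a,x) > 0 and m(x,b) > 0. Then |(α·m(x,b) − β·m(a,x))·F_w(x) − m(a,x)·[(α+β)·m(x,b)·f(x) − β]| ≤ (1/2)·m(x,b)·m(a,x)·(α + β + |α−β|)·‖f'‖_1. -/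
open MeasureTheory intervalIntegral

/-- If `f` stays within `K` of the value `y`, then so does its `w`-weighted mean. -/
theorem abs_integral_mul_sub_le {c d y K : ℝ} (hcd : c ≤ d) {f w : ℝ → ℝ}
    (hfw : IntervalIntegrable (fun u => f u * w u) volume c d)
    (hw : IntervalIntegrable w volume c d) (hw_nonneg : ∀ u ∈ Set.Icc c d, 0 ≤ w u)
    (hf : ∀ u ∈ Set.Icc c d, |f u - y| ≤ K) :
    |(∫ u in c..d, f u * w u) - (∫ u in c..d, w u) * y| ≤ (∫ u in c..d, w u) * K := by
  have hsub : (∫ u in c..d, f u * w u) - (∫ u in c..d, w u) * y =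
      ∫ u in c..d, (f u * w u - w u * y) := by
    rw [integral_sub hfw (hw.mul_const y), intervalIntegral.integral_mul_const]
  rw [hsub, ← intervalIntegral.integral_mul_const]
  refine (abs_integral_le_integral_abs hcd).trans
    (integral_mono_on hcd (hfw.sub (hw.mul_const y)).abs (hw.mul_const K) fun u hu => ?_)
  rw [show f u * w u - w u * y = w u * (f u - y) by ring, abs_mul, abs_of_nonneg (hw_nonneg u hu)]
  exact mul_le_mul_of_nonneg_left (hf u hu) (hw_nonneg u hu)

/-- The increments of an absolutely continuous function on `[c, d]` are bounded by the
`L¹` norm of its derivative on `[c, d]`. -/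
theorem abs_sub_le_integral_abs_of_eq_add_integral {a b c d : ℝ} {f f' : ℝ → ℝ}
    (hac : a ≤ c) (hdb : d ≤ b) (hf' : IntervalIntegrable f' volume a b)
    (hftc : ∀ y ∈ Set.Icc a b, f y = f a + ∫ t in a..y, f' t)
    {u v : ℝ} (hu : u ∈ Set.Icc c d) (hv : v ∈ Set.Icc c d) :
    |f u - f v| ≤ ∫ t in c..d, |f' t| := by
  wlog huv : v ≤ u generalizing u v
  · rw [abs_sub_comm]
    exact this hv hu (le_of_not_ge huv)
  have hcd : c ≤ d := hu.1.trans hu.2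
  have hab : a ≤ b := hac.trans (hcd.trans hdb)
  have hint : ∀ {p q : ℝ}, p ∈ Set.Icc a b → q ∈ Set.Icc a b →
      IntervalIntegrable f' volume p q := fun hp hq =>
    hf'.mono_set (Set.uIcc_subset_uIcc (Set.Icc_subset_uIcc hp) (Set.Icc_subset_uIcc hq))
  have hu' : u ∈ Set.Icc a b := ⟨hac.trans hu.1, hu.2.trans hdb⟩
  have hv' : v ∈ Set.Icc a b := ⟨hac.trans hv.1, hv.2.trans hdb⟩
  have ha : a ∈ Set.Icc a b := Set.left_mem_Icc.2 hab
  have hdiff : f u - f v = ∫ t in v..u, f' t := by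
    rw [hftc u hu', hftc v hv', add_sub_add_left_eq_sub,
      integral_interval_sub_left (hint ha hu') (hint ha hv')]
  rw [hdiff]
  exact (abs_integral_le_integral_abs huv).trans
    (integral_mono_interval hv.1 huv hu.2 (Filter.Eventually.of_forall fun t => abs_nonneg (f' t))
      (hint ⟨hac, hcd.trans hdb⟩ ⟨hac.trans hcd, hdb⟩).abs)

/-- **Theorem 4, `L_1` case** (application to the weighted cumulative distribution
function). Let `f ≥ 0` be an absolutely continuous probability density with respect to
the weight `w` on `[a,b]` (i.e. `∫_a^b f·w = 1`), expressed via the fundamental theorem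
of calculus with integrable density `f'`, let `w ≥ 0` be integrable, `α, β ≥ 0` with
`α + β > 0`, and let `x ∈ (a,b)` satisfy `m(a,x) > 0` and `m(x,b) > 0`. Then with
`F_w(x) = ∫_a^x f·w`,
`|(α·m(x,b) − β·m(a,x))·F_w(x) − m(a,x)·((α+β)·m(x,b)·f(x) − β)|
  ≤ (1/2)·m(x,b)·m(a,x)·(α + β + |α−β|)·‖f'‖_1`. -/
theorem weighted_cdf_L1 (a b : ℝ) (hab : a < b) (f f' w : ℝ → ℝ) (α β : ℝ)
    (hα : 0 ≤ α) (hβ : 0 ≤ β) (hαβ : 0 < α + β)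
    (hf_nonneg : ∀ t ∈ Set.Icc a b, 0 ≤ f t)
    (hw_int : IntervalIntegrable w volume a b)
    (hw_nonneg : ∀ t ∈ Set.Icc a b, 0 ≤ w t)
    (hf'int : IntervalIntegrable f' volume a b)
    (hftc : ∀ y ∈ Set.Icc a b, f y = f a + ∫ t in a..y, f' t)
    (hpdf : (∫ u in a..b, f u * w u) = 1)
    (x : ℝ) (hx : x ∈ Set.Ioo a b)
    (hmax : 0 < ∫ t in a..x, w t) (hmxb : 0 < ∫ t in x..b, w t) :
    |(α * (∫ t in x..b, w t) - β * (∫ t in a..x, w t)) * (∫ u in a..x, f u * w u) -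
        (∫ t in a..x, w t) * ((α + β) * (∫ t in x..b, w t) * f x - β)| ≤
      (1 / 2) * (∫ t in x..b, w t) * (∫ t in a..x, w t) * (α + β + |α - β|) *
        ∫ t in a..b, |f' t| := by
  have hxI : x ∈ Set.Icc a b := Set.Ioo_subset_Icc_self hx
  have hax : a ≤ x := hxI.1
  have hxb : x ≤ b := hxI.2
  have hcont : ContinuousOn f (Set.uIcc a b) := by
    refine ((continuousOn_const (c := f a)).add
      (continuousOn_primitive_interval' hf'int Set.left_mem_uIcc)).congr fun y hy => ?_
    exact hftc y (Set.uIcc_of_le hab.le ▸ hy)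
  have hfw : IntervalIntegrable (fun u => f u * w u) volume a b :=
    hw_int.continuousOn_mul hcont
  have hl : Set.uIcc a x ⊆ Set.uIcc a b :=
    Set.uIcc_subset_uIcc_left (Set.Icc_subset_uIcc hxI)
  have hr : Set.uIcc x b ⊆ Set.uIcc a b :=
    Set.uIcc_subset_uIcc_right (Set.Icc_subset_uIcc hxI)
  have hleft := abs_integral_mul_sub_le hax (hfw.mono_set hl) (hw_int.mono_set hl)
    (fun u hu => hw_nonneg u ⟨hu.1, hu.2.trans hxb⟩)
    (fun u hu => abs_sub_le_integral_abs_of_eq_add_integral le_rfl hxb hf'int hftc hu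
      (Set.right_mem_Icc.2 hax))
  have hright := abs_integral_mul_sub_le hxb (hfw.mono_set hr) (hw_int.mono_set hr)
    (fun u hu => hw_nonneg u ⟨hax.trans hu.1, hu.2⟩)
    (fun u hu => abs_sub_le_integral_abs_of_eq_add_integral hax le_rfl hf'int hftc hu
      (Set.left_mem_Icc.2 hxb))
  have hvar := integral_add_adjacent_intervals (hf'int.abs.mono_set hl) (hf'int.abs.mono_set hr)
  have hmass := integral_add_adjacent_intervals (hfw.mono_set hl) (hfw.mono_set hr)
  rw [hpdf] at hmass
  have hV₁ : 0 ≤ ∫ t in a..x, |f' t| := integral_nonneg hax fun t _ => abs_nonneg _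
  have hV₂ : 0 ≤ ∫ t in x..b, |f' t| := integral_nonneg hxb fun t _ => abs_nonneg _
  rw [← hvar]
  set A := ∫ t in a..x, w t
  set B := ∫ t in x..b, w t
  set G := ∫ u in a..x, f u * w u
  set H := ∫ u in x..b, f u * w u
  set V₁ := ∫ t in a..x, |f' t|
  set V₂ := ∫ t in x..b, |f' t|
  have hα_le : α ≤ (1 / 2) * (α + β + |α - β|) := by linarith [le_abs_self (α - β)]
  have hβ_le : β ≤ (1 / 2) * (α + β + |α - β|) := by linarith [neg_abs_le (α - β)]
  calc |(α * B - β * A) * G - A * ((α + β) * B * f x - β)|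
      = |α * B * (G - A * f x) + β * A * (H - B * f x)| := by
        congr 1
        linear_combination (-(A * β)) * hmass
    _ ≤ α * B * |G - A * f x| + β * A * |H - B * f x| := by
        refine (abs_add_le _ _).trans_eq ?_
        rw [abs_mul, abs_mul (β * A), abs_of_nonneg (mul_nonneg hα hmxb.le),
          abs_of_nonneg (mul_nonneg hβ hmax.le)]
    _ ≤ α * B * (A * V₁) + β * A * (B * V₂) := by gcongr
    _ = B * A * (α * V₁ + β * V₂) := by ring
    _ ≤ B * A * ((1 / 2) * (α + β + |α - β|) * V₁ + (1 / 2) * (α + β + |α - β|) * V₂) := by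
        gcongr
    _ = (1 / 2) * B * A * (α + β + |α - β|) * (V₁ + V₂) := by ring
end
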